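/- arXiv:1904.03090 — 2 statements merged into one kernel-verified Lean document; each statement's English description precedes it below -/
import Mathlib

section
/- The number of rooted planar bipartite trees (double trees) with 2q edges, where vertices alternate between i-type and j-type, having exactly k+1 i-type vertices and q-k j-type vertices, equals the Narayana number (1/(k+1)) * C(q,k) * C(q-1,k). -/
/-- Rooted planar trees: a root with an ordered list of subtrees. -/
inductive PlaneTree where
  | node : List PlaneTree → PlaneTree

namespace PlaneTree

/-- Number of edges of a rooted plane tree. -/
def numEdges : PlaneTree → ℕ
  | node ts => ts.length + (ts.attach.map (fun t => numEdges t.1)).sum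
decreasing_by
  have := List.sizeOf_lt_of_mem t.2
  simp only [PlaneTree.node.sizeOf_spec]
  omega

/-- Number of vertices at even depth (if `b = true`) respectively odd depth
(if `b = false`), the root having depth `0`. -/
def countParity : PlaneTree → Bool → ℕ
  | node ts, b => (if b then 1 else 0) + (ts.attach.map (fun t => countParity t.1 !b)).sum
termination_by t _ => sizeOf t
decreasing_by
  have := List.sizeOf_lt_of_mem t.2
  simp only [PlaneTree.node.sizeOf_spec]
  omega

end PlaneTree

namespace PlaneTree

theorem numEdges_node (ts : List PlaneTree) :
    numEdges (node ts) = ts.length + (ts.map numEdges).sum := by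
  rw [numEdges, List.attach_map_val (f := numEdges)]

theorem countParity_node (ts : List PlaneTree) (b : Bool) :
    countParity (node ts) b = (if b then 1 else 0) + (ts.map (countParity · !b)).sum := by
  rw [countParity, List.attach_map_val (f := (countParity · !b))]

theorem one_le_countParity_true (t : PlaneTree) : 1 ≤ countParity t true := by
  cases t
  simp [countParity_node]

theorem countParity_node_cons (t : PlaneTree) (ts : List PlaneTree) (b : Bool) :
    countParity (node (t :: ts)) b = countParity t (!b) + countParity (node ts) b := by
  simp only [countParity_node, List.map_cons, List.sum_cons]
  omega

theorem numEdges_node_cons (t : PlaneTree) (ts : List PlaneTree) :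
    numEdges (node (t :: ts)) = numEdges t + 1 + numEdges (node ts) := by
  simp only [numEdges_node, List.map_cons, List.sum_cons, List.length_cons]
  omega

theorem countParity_true_add_false : ∀ t : PlaneTree,
    countParity t true + countParity t false = numEdges t + 1
  | node [] => by simp [countParity_node, numEdges_node]
  | node (t :: ts) => by
    have h₁ := countParity_true_add_false t
    have h₂ := countParity_true_add_false (node ts)
    simp only [countParity_node_cons, numEdges_node_cons, Bool.not_true, Bool.not_false]
    omega

/-- Number of vertices of a forest of the parity given by `b`, where the roots of `p.1` have
depth `0` and the roots of `p.2` have depth `1`. -/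
def forestParity (p : List PlaneTree × List PlaneTree) (b : Bool) : ℕ :=
  (p.1.map (countParity · b)).sum + (p.2.map (countParity · !b)).sum

/-- Forests with `r` even roots, `s` odd roots, `a` even vertices and `b` odd vertices. -/
def forests (r s a b : ℕ) : Set (List PlaneTree × List PlaneTree) :=
  {p | p.1.length = r ∧ p.2.length = s ∧ forestParity p true = a ∧ forestParity p false = b}

theorem length_le_sum_countParity_true (l : List PlaneTree) :
    l.length ≤ (l.map (countParity · true)).sum := by
  induction l with
  | nil => simp
  | cons t l ih =>
    have := one_le_countParity_true t
    simp only [List.map_cons, List.sum_cons, List.length_cons]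
    omega

theorem forests_eq_empty_of_lt {r s a b : ℕ} (h : b < s) : forests r s a b = ∅ := by
  ext ⟨l, m⟩
  have := length_le_sum_countParity_true m
  simp only [forests, forestParity, Set.mem_ofPred_eq, Set.mem_empty_iff_false, iff_false,
    Bool.not_false]
  omega

theorem encard_forests_swap (r s a b : ℕ) : (forests r s a b).encard = (forests s r b a).encard := by
  rw [← Prod.swap_injective.encard_image (forests r s a b), Set.image_swap_eq_preimage_swap]
  congr 1
  ext ⟨l, m⟩
  simp only [forests, forestParity, Set.mem_preimage, Set.mem_ofPred_eq, Prod.swap_prod_mk,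
    Bool.not_true, Bool.not_false]
  omega

theorem encard_setOf_countParity (a b : ℕ) :
    {t : PlaneTree | countParity t true = a ∧ countParity t false = b}.encard
      = (forests 1 0 a b).encard := by
  have hinj : Function.Injective fun t : PlaneTree => (([t], []) : List PlaneTree × List PlaneTree) :=
    fun t t' h => by simpa using h
  rw [← hinj.encard_image]
  congr 1
  ext ⟨l, m⟩
  simp only [forests, forestParity, Set.mem_image, Set.mem_ofPred_eq, Prod.mk.injEq]
  constructor
  · rintro ⟨t, ⟨rfl, rfl⟩, rfl, rfl⟩
    simp
  · rintro ⟨hl, hm, ha, hb⟩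
    obtain ⟨t, rfl⟩ := List.length_eq_one_iff.mp hl
    obtain rfl := List.length_eq_zero_iff.mp hm
    exact ⟨t, by simpa using ⟨ha, hb⟩, rfl, rfl⟩

/-- Attach the first odd-rooted tree as leftmost subtree of the first even root. -/
def graft : List PlaneTree × List PlaneTree → List PlaneTree × List PlaneTree
  | (node ts :: l, t :: m) => (node (t :: ts) :: l, m)
  | p => p

theorem injOn_graft (r s a b : ℕ) : Set.InjOn graft (forests (r + 1) (s + 1) a b) := by
  rintro ⟨_ | ⟨⟨ts⟩, l⟩, _ | ⟨t, m⟩⟩ h ⟨_ | ⟨⟨ts'⟩, l'⟩, _ | ⟨t', m'⟩⟩ h' e <;>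
    simp_all [forests, graft]

theorem forests_succ (r s a b : ℕ) :
    forests (r + 1) s (a + 1) b
      = Prod.map (node [] :: ·) id '' forests r s a b
        ∪ graft '' forests (r + 1) (s + 1) (a + 1) b := by
  ext ⟨l, m⟩
  constructor
  · rintro ⟨hl, hm, ha, hb⟩
    obtain _ | ⟨⟨_ | ⟨t, ts⟩⟩, l⟩ := l
    · simp at hl
    · refine Or.inl ⟨(l, m), ⟨by simpa using hl, hm, ?_, ?_⟩, rfl⟩ <;>
      · simp [forestParity, countParity_node] at ha hb ⊢
        omega
    · refine Or.inr ⟨(node ts :: l, t :: m), ⟨hl, by simpa using hm, ?_, ?_⟩, rfl⟩ <;>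
      · simp [forestParity, countParity_node_cons] at ha hb ⊢
        omega
  · rintro (⟨⟨l', m'⟩, ⟨hl, hm, ha, hb⟩, e⟩ | ⟨⟨l', m'⟩, ⟨hl, hm, ha, hb⟩, e⟩)
    · obtain ⟨rfl, rfl⟩ := Prod.mk.inj e
      refine ⟨by simpa using hl, hm, ?_, ?_⟩ <;>
      · simp [forestParity, countParity_node] at ha hb ⊢
        omega
    · obtain _ | ⟨⟨ts⟩, l'⟩ := l'
      · simp at hl
      obtain _ | ⟨t, m'⟩ := m'
      · simp at hm
      obtain ⟨rfl, rfl⟩ := Prod.mk.inj e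
      refine ⟨hl, by simpa using hm, ?_, ?_⟩ <;>
      · simp [forestParity, countParity_node_cons] at ha hb ⊢
        omega

theorem encard_forests_succ (r s a b : ℕ) :
    (forests (r + 1) s (a + 1) b).encard
      = (forests r s a b).encard + (forests (r + 1) (s + 1) (a + 1) b).encard := by
  rw [forests_succ, Set.encard_union_eq, (injOn_graft _ _ _ _).encard_image,
    Function.Injective.encard_image]
  · exact (List.cons_injective).prodMap Function.injective_id
  · rw [Set.disjoint_left]
    rintro _ ⟨⟨l, m⟩, -, rfl⟩ ⟨⟨_ | ⟨⟨ts⟩, l'⟩, _ | ⟨t, m'⟩⟩, h, e⟩ <;>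
      simp_all [forests, graft]

theorem forests_zero_zero (a b : ℕ) :
    forests 0 0 a b = if a = 0 ∧ b = 0 then {([], [])} else ∅ := by
  ext ⟨l, m⟩
  split_ifs with h <;>
    simp only [forests, forestParity, Set.mem_ofPred_eq, List.length_eq_zero_iff,
      Set.mem_singleton_iff, Prod.mk.injEq, Set.mem_empty_iff_false, iff_false]
  · constructor
    · exact fun h' => ⟨h'.1, h'.2.1⟩
    · rintro ⟨rfl, rfl⟩
      simp [h]
  · rintro ⟨rfl, rfl, ha, hb⟩
    exact h ⟨by simpa using ha.symm, by simpa using hb.symm⟩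

/-- The number `multichoose (a + 1) (v - 1)`, read as `0` for `v = 0`. -/
def shiftedMultichoose (a : ℕ) : ℕ → ℕ
  | 0 => 0
  | v + 1 => Nat.multichoose (a + 1) v

theorem shiftedMultichoose_succ_succ (a v : ℕ) :
    shiftedMultichoose (a + 1) (v + 1)
      = shiftedMultichoose (a + 1) v + shiftedMultichoose a (v + 1) := by
  cases v with
  | zero => simp [shiftedMultichoose]
  | succ v => simp only [shiftedMultichoose, Nat.multichoose_succ_succ (a + 1) v]; omega

theorem multichoose_mul_multichoose_swap (u v : ℕ) (h : ¬(u = 0 ∧ v = 0)) :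
    shiftedMultichoose u v * shiftedMultichoose v u
      = Nat.multichoose u v * Nat.multichoose v u := by
  rcases u with _ | u <;> rcases v with _ | v
  · simp at h
  · simp [shiftedMultichoose]
  · simp [shiftedMultichoose]
  · simp only [shiftedMultichoose, Nat.multichoose_eq]
    rw [show u + 1 + 1 + v - 1 = u + 1 + v by omega, show v + 1 + 1 + u - 1 = u + 1 + v by omega,
      show u + 1 + (v + 1) - 1 = u + 1 + v by omega, show v + 1 + (u + 1) - 1 = u + 1 + v by omega,
      Nat.choose_symm_add, Nat.choose_symm_of_eq_add (show u + 1 + v = u + (v + 1) by omega),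
      mul_comm]

/-- The closed form for the number of forests, in subtraction-free form. -/
def ForestCount (r s u v : ℕ) : Prop :=
  ∃ n : ℕ, (forests r s (r + u) (s + v)).encard = n ∧
    n + shiftedMultichoose (r + u) v * shiftedMultichoose (s + v) u
      = Nat.multichoose (r + u) v * Nat.multichoose (s + v) u

theorem ForestCount.swap {r s u v : ℕ} : ForestCount r s u v → ForestCount s r v u := by
  rintro ⟨n, hn, h⟩
  exact ⟨n, by rw [encard_forests_swap, hn], by rw [mul_comm, h, mul_comm]⟩

theorem ForestCount.succ {r s u v : ℕ} (h : ForestCount r s u v)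
    (h' : ∀ v', v = v' + 1 → ForestCount (r + 1) (s + 1) u v') : ForestCount (r + 1) s u v := by
  obtain ⟨n, hn, e⟩ := h
  rw [ForestCount, show r + 1 + u = r + u + 1 by omega, encard_forests_succ, hn]
  rcases v with _ | v
  · refine ⟨n, ?_, ?_⟩
    · rw [forests_eq_empty_of_lt (by omega)]
      simp
    · simpa [shiftedMultichoose] using e
  · obtain ⟨n', hn', e'⟩ := h' v rfl
    rw [show r + 1 + u = r + u + 1 by omega, show s + 1 + v = s + (v + 1) by omega] at hn' e'
    refine ⟨n + n', by rw [hn']; push_cast; rfl, ?_⟩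
    rw [shiftedMultichoose_succ_succ, Nat.multichoose_succ_succ]
    linarith

theorem forestCount_zero_zero (u v : ℕ) : ForestCount 0 0 u v := by
  rw [ForestCount, forests_zero_zero]
  simp only [zero_add]
  split_ifs with h
  · obtain ⟨rfl, rfl⟩ := h
    exact ⟨1, by simp, by simp [shiftedMultichoose]⟩
  · exact ⟨0, by simp, by rw [zero_add, multichoose_mul_multichoose_swap u v h]⟩

theorem forestCount : ∀ r s u v : ℕ, ForestCount r s u v
  | 0, 0, u, v => forestCount_zero_zero u v
  | r + 1, s, u, v => (forestCount r s u v).succ fun v' _ => forestCount (r + 1) (s + 1) u v'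
  | 0, s + 1, u, v =>
    ((forestCount 0 s u v).swap.succ fun u' _ => (forestCount 1 (s + 1) u' v).swap).swap
termination_by r s u v => (u + v, r + s)

end PlaneTree

open PlaneTree in
theorem narayana_of_add_eq {n k m : ℕ}
    (h : n + shiftedMultichoose (1 + k) (m + 1) * shiftedMultichoose (m + 1) k
      = Nat.multichoose (1 + k) (m + 1) * Nat.multichoose (m + 1) k) :
    n * (k + 1) = (k + m + 1).choose k * (k + m).choose k := by
  have h₁ : Nat.multichoose (1 + k) (m + 1) = (k + m + 1).choose k := by
    rw [Nat.multichoose_eq, show 1 + k + (m + 1) - 1 = k + (m + 1) by omega, ← Nat.choose_symm_add,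
      add_assoc]
  have h₂ : Nat.multichoose (m + 1) k = (k + m).choose k := by
    rw [Nat.multichoose_eq, show m + 1 + k - 1 = k + m by omega]
  have h₃ : shiftedMultichoose (1 + k) (m + 1) * (k + 1) = (k + m + 1).choose k * (m + 1) := by
    rw [shiftedMultichoose, Nat.multichoose_eq, show 1 + k + 1 + m - 1 = k + 1 + m by omega,
      ← Nat.choose_symm_add, show k + 1 + m = k + m + 1 by omega, Nat.choose_succ_right_eq,
      show k + m + 1 - k = m + 1 by omega]
  have h₄ : shiftedMultichoose (m + 1) k * (m + 1) = (k + m).choose k * k := by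
    rcases k with _ | k
    · simp [shiftedMultichoose]
    · rw [shiftedMultichoose, Nat.multichoose_eq, show m + 1 + 1 + k - 1 = k + 1 + m by omega,
        Nat.choose_succ_right_eq, show k + 1 + m - k = m + 1 by omega]
  rw [h₁, h₂] at h
  generalize (k + m + 1).choose k = P at *
  generalize (k + m).choose k = Q at *
  have h₅ : shiftedMultichoose (1 + k) (m + 1) * shiftedMultichoose (m + 1) k * (k + 1)
      = P * Q * k := by
    rw [mul_right_comm, h₃, mul_assoc, mul_comm (m + 1), h₄, mul_assoc]
  have h₆ := congrArg (· * (k + 1)) h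
  simp only [add_mul, h₅] at h₆
  linarith

/-- The number of rooted planar bipartite trees (double trees, i.e. trees each of whose
edges is doubled into a cycle of length 2, giving `2q` edges) whose vertices alternate
between i-type (even depth) and j-type (odd depth), with exactly `k+1` i-type vertices
and `q-k` j-type vertices, equals the Narayana number `(1/(k+1)) * C(q,k) * C(q-1,k)`. -/
theorem doubleTree_count_eq_narayana (q k : ℕ) (hq : 1 ≤ q) (hk : k < q) :
    {t : PlaneTree | t.numEdges = q ∧ t.countParity true = k + 1 ∧
        t.countParity false = q - k}.ncard
      = q.choose k * (q - 1).choose k / (k + 1) := by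
  have hset : {t : PlaneTree | t.numEdges = q ∧ t.countParity true = k + 1 ∧
      t.countParity false = q - k}
      = {t | t.countParity true = 1 + k ∧ t.countParity false = 0 + (q - k)} := by
    ext t
    have := t.countParity_true_add_false
    simp only [Set.mem_ofPred_eq]
    omega
  obtain ⟨m, rfl⟩ := Nat.exists_eq_add_of_lt hk
  rw [hset, show k + m + 1 - k = m + 1 by omega, Set.ncard_def, PlaneTree.encard_setOf_countParity]
  obtain ⟨n, hn, h⟩ := PlaneTree.forestCount 1 0 k (m + 1)
  rw [zero_add] at h
  rw [hn, ENat.toNat_natCast, Nat.add_sub_cancel, ← narayana_of_add_eq h,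
    Nat.mul_div_cancel _ k.succ_pos]
end

section
/- For every nonnegative integer q, the q-th moment of the Marčenko–Pastur distribution with shape parameter λ > 0 equals the sum over k from 0 to q-1 of λ^k * (1/(k+1)) * C(q,k) * C(q-1,k) (with the 0-th moment equal to 1). -/
open MeasureTheory

/-- The Marčenko–Pastur distribution with shape parameter `l ∈ (0,1]`: the measure on
`[(1-√l)², (1+√l)²]` with density `(1/(2πlx))·√((b-x)(x-a))` w.r.t. Lebesgue measure. -/
noncomputable def mpMeasure (l : ℝ) : Measure ℝ :=
  volume.withDensity (fun x =>
    ENNReal.ofReal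
      (Set.indicator (Set.Icc ((1 - Real.sqrt l) ^ 2) ((1 + Real.sqrt l) ^ 2))
        (fun y => (1 / (2 * Real.pi * l * y)) *
          Real.sqrt (((1 + Real.sqrt l) ^ 2 - y) * (y - (1 - Real.sqrt l) ^ 2))) x))

theorem cast_choose_succ_mul (n k : ℕ) :
    (n.choose (k + 1) : ℝ) * (k + 1) = n.choose k * (n - k) := by
  rcases le_or_gt k n with h | h
  · have := Nat.choose_succ_right_eq n k
    rw [← Nat.cast_sub h]
    exact_mod_cast this
  · simp [Nat.choose_eq_zero_of_lt h, Nat.choose_eq_zero_of_lt (Nat.lt_succ_of_lt h)]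

theorem narayana_eq_choose_sq_sub (n k : ℕ) :
    1 / ((k + 1 : ℕ) + 1 : ℝ) * ((n + 1).choose (k + 1) : ℝ) * (n.choose (k + 1) : ℝ)
      = (n.choose (k + 1) : ℝ) ^ 2 - n.choose k * n.choose (k + 2) := by
  have h1 := cast_choose_succ_mul n k
  have h2 := cast_choose_succ_mul n (k + 1)
  have hk : ((k : ℝ) + 1 + 1) ≠ 0 := by positivity
  rw [Nat.choose_succ_succ]
  push_cast at *
  rw [one_div, mul_assoc, inv_mul_eq_iff_eq_mul₀ hk]
  linear_combination (-(n.choose (k + 1) : ℝ)) * h1 + (n.choose k : ℝ) * h2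

theorem sum_narayana_eq (n : ℕ) (l : ℝ) :
    ∑ k ∈ Finset.range (n + 1),
        l ^ k * (1 / (k + 1 : ℝ)) * ((n + 1).choose k : ℝ) * (n.choose k : ℝ)
      = ∑ k ∈ Finset.range (n + 1), l ^ k * (n.choose k : ℝ) ^ 2
        - ∑ k ∈ Finset.range (n + 1), l ^ (k + 1) * (n.choose k * n.choose (k + 2) : ℝ) := by
  rw [Finset.sum_range_succ', Finset.sum_range_succ' (fun k => l ^ k * (n.choose k : ℝ) ^ 2),
    Finset.sum_range_succ (fun k => l ^ (k + 1) * (n.choose k * n.choose (k + 2) : ℝ)),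
    Nat.choose_eq_zero_of_lt (show n < n + 2 by omega)]
  have : ∀ k ∈ Finset.range n, l ^ (k + 1) * (1 / ((k + 1 : ℕ) + 1 : ℝ)) *
      ((n + 1).choose (k + 1) : ℝ) * (n.choose (k + 1) : ℝ)
      = l ^ (k + 1) * (n.choose (k + 1) : ℝ) ^ 2
        - l ^ (k + 1) * (n.choose k * n.choose (k + 2) : ℝ) := by
    intro k _
    rw [← mul_sub, ← narayana_eq_choose_sq_sub]
    ring
  rw [Finset.sum_congr rfl this, Finset.sum_sub_distrib]
  simp
  ring

theorem one_add_sq_add_two_mul_cos_pow (s θ : ℝ) (n : ℕ) :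
    (1 + s ^ 2 + 2 * s * Real.cos θ) ^ n
      = ∑ j ∈ Finset.range (n + 1), ∑ k ∈ Finset.range (n + 1),
          s ^ (j + k) * (n.choose j * n.choose k : ℝ) * Real.cos (((j - k : ℤ) : ℝ) * θ) := by
  have hy : ((1 + s ^ 2 + 2 * s * Real.cos θ : ℝ) : ℂ)
      = (s * Complex.exp (θ * Complex.I) + 1) * (s * Complex.exp (-θ * Complex.I) + 1) := by
    have h : Complex.exp (θ * Complex.I) * Complex.exp (-θ * Complex.I) = 1 := by
      rw [← Complex.exp_add]; simp
    push_cast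
    rw [Complex.cos]
    linear_combination (-(s : ℂ) ^ 2) * h
  have hc : (((1 + s ^ 2 + 2 * s * Real.cos θ) ^ n : ℝ) : ℂ)
      = ∑ j ∈ Finset.range (n + 1), ∑ k ∈ Finset.range (n + 1),
          ((s ^ (j + k) * (n.choose j * n.choose k : ℝ) : ℝ) : ℂ)
            * Complex.exp (((((j - k : ℤ) : ℝ) * θ : ℝ) : ℂ) * Complex.I) := by
    rw [Complex.ofReal_pow, hy, mul_pow, add_pow, add_pow, Finset.sum_mul_sum]
    refine Finset.sum_congr rfl fun j _ => Finset.sum_congr rfl fun k _ => ?_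
    have : Complex.exp (((((j - k : ℤ) : ℝ) * θ : ℝ) : ℂ) * Complex.I)
        = Complex.exp (θ * Complex.I) ^ j * Complex.exp (-θ * Complex.I) ^ k := by
      rw [← Complex.exp_nat_mul, ← Complex.exp_nat_mul, ← Complex.exp_add]
      congr 1
      push_cast
      ring
    rw [this, mul_pow, mul_pow]
    push_cast
    ring
  have := congrArg Complex.re hc
  rw [Complex.ofReal_re] at this
  rw [this, Complex.re_sum]
  refine Finset.sum_congr rfl fun j _ => ?_
  rw [Complex.re_sum]
  refine Finset.sum_congr rfl fun k _ => ?_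
  rw [Complex.re_ofReal_mul, Complex.exp_ofReal_mul_I_re]

theorem integral_cos_int_mul (m : ℤ) :
    ∫ θ in (0 : ℝ)..Real.pi, Real.cos (m * θ) = if m = 0 then Real.pi else 0 := by
  split_ifs with h
  · simp [h]
  · rw [intervalIntegral.integral_comp_mul_left _ (by exact_mod_cast h)]
    simp [Real.sin_int_mul_pi]

theorem integral_sin_sq_mul_cos_int_mul (m : ℤ) :
    ∫ θ in (0 : ℝ)..Real.pi, Real.sin θ ^ 2 * Real.cos (m * θ)
      = Real.pi / 2 * (if m = 0 then 1 else 0) - Real.pi / 4 * (if m = 2 then 1 else 0)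
        - Real.pi / 4 * (if m = -2 then 1 else 0) := by
  have h : ∀ θ : ℝ, Real.sin θ ^ 2 * Real.cos (m * θ)
      = 1 / 2 * Real.cos (m * θ) - 1 / 4 * Real.cos ((m - 2 : ℤ) * θ)
        - 1 / 4 * Real.cos ((m + 2 : ℤ) * θ) := by
    intro θ
    push_cast
    rw [sub_mul, add_mul, Real.cos_sub, Real.cos_add, Real.cos_two_mul, Real.cos_sq']
    ring
  have hi : ∀ (c : ℝ) (k : ℤ), IntervalIntegrable (fun θ : ℝ => c * Real.cos (k * θ)) volume
      0 Real.pi := fun c k => (by fun_prop : Continuous _).intervalIntegrable _ _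
  simp_rw [h]
  rw [intervalIntegral.integral_sub ((hi _ _).sub (hi _ _)) (hi _ _),
    intervalIntegral.integral_sub (hi _ _) (hi _ _)]
  simp_rw [intervalIntegral.integral_const_mul, integral_cos_int_mul]
  simp only [sub_eq_zero, ← eq_neg_iff_add_eq_zero]
  split_ifs <;> ring

theorem integral_sin_sq_mul_pow (s : ℝ) (n : ℕ) :
    ∫ θ in (0 : ℝ)..Real.pi, Real.sin θ ^ 2 * (1 + s ^ 2 + 2 * s * Real.cos θ) ^ n
      = Real.pi / 2 * (∑ k ∈ Finset.range (n + 1), (s ^ 2) ^ k * (n.choose k : ℝ) ^ 2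
        - ∑ k ∈ Finset.range (n + 1),
            (s ^ 2) ^ (k + 1) * (n.choose k * n.choose (k + 2) : ℝ)) := by
  have hterm : ∀ j k : ℕ, ∫ θ in (0 : ℝ)..Real.pi, Real.sin θ ^ 2 *
      (s ^ (j + k) * (n.choose j * n.choose k : ℝ) * Real.cos (((j - k : ℤ) : ℝ) * θ))
      = s ^ (j + k) * (n.choose j * n.choose k : ℝ) * (Real.pi / 2 * (if j = k then 1 else 0)
        - Real.pi / 4 * (if j = k + 2 then 1 else 0)
        - Real.pi / 4 * (if k = j + 2 then 1 else 0)) := by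
    intro j k
    simp_rw [mul_left_comm (Real.sin _ ^ 2)]
    rw [intervalIntegral.integral_const_mul, integral_sin_sq_mul_cos_int_mul]
    have h0 : ((j : ℤ) - k = 0) ↔ j = k := by omega
    have h2 : ((j : ℤ) - k = 2) ↔ j = k + 2 := by omega
    have h3 : ((j : ℤ) - k = -2) ↔ k = j + 2 := by omega
    simp only [h0, h2, h3]
  have hshift : ∀ k ∈ Finset.range (n + 1), (∑ j ∈ Finset.range (n + 1),
      s ^ (j + k) * (n.choose j * n.choose k : ℝ) * (if j = k + 2 then 1 else 0))
      = (s ^ 2) ^ (k + 1) * (n.choose k * n.choose (k + 2) : ℝ) := by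
    intro k _
    simp only [mul_ite, mul_one, mul_zero, Finset.sum_ite_eq', Finset.mem_range]
    split_ifs with h
    · ring
    · rw [Nat.choose_eq_zero_of_lt (show n < k + 2 by omega)]
      simp
  have hdiag : ∀ k ∈ Finset.range (n + 1), (∑ j ∈ Finset.range (n + 1),
      s ^ (k + j) * (n.choose k * n.choose j : ℝ) * (if k = j then 1 else 0))
      = (s ^ 2) ^ k * (n.choose k : ℝ) ^ 2 := by
    intro k hk
    simp only [mul_ite, mul_one, mul_zero, Finset.sum_ite_eq, if_pos hk]
    ring
  simp_rw [one_add_sq_add_two_mul_cos_pow, Finset.mul_sum]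
  rw [intervalIntegral.integral_finsetSum fun j _ =>
    (by fun_prop : Continuous _).intervalIntegrable _ _]
  have hinner : ∀ j ∈ Finset.range (n + 1), ∫ θ in (0 : ℝ)..Real.pi,
      ∑ k ∈ Finset.range (n + 1), Real.sin θ ^ 2 *
      (s ^ (j + k) * (n.choose j * n.choose k : ℝ) * Real.cos (((j - k : ℤ) : ℝ) * θ))
      = ∑ k ∈ Finset.range (n + 1), s ^ (j + k) * (n.choose j * n.choose k : ℝ) *
        (Real.pi / 2 * (if j = k then 1 else 0)
        - Real.pi / 4 * (if j = k + 2 then 1 else 0)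
        - Real.pi / 4 * (if k = j + 2 then 1 else 0)) := by
    intro j _
    rw [intervalIntegral.integral_finsetSum fun j _ =>
      (by fun_prop : Continuous _).intervalIntegrable _ _]
    exact Finset.sum_congr rfl fun k _ => hterm j k
  rw [Finset.sum_congr rfl hinner]
  simp_rw [mul_sub, Finset.sum_sub_distrib, mul_left_comm _ (Real.pi / _), ← Finset.mul_sum]
  rw [Finset.sum_congr rfl hdiag]
  rw [Finset.sum_comm (f := fun j k => s ^ (j + k) * (n.choose j * n.choose k : ℝ) *
    (if j = k + 2 then 1 else 0)), Finset.sum_congr rfl hshift]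
  have hshift' : ∀ j ∈ Finset.range (n + 1), (∑ k ∈ Finset.range (n + 1),
      s ^ (j + k) * (n.choose j * n.choose k : ℝ) * (if k = j + 2 then 1 else 0))
      = (s ^ 2) ^ (j + 1) * (n.choose j * n.choose (j + 2) : ℝ) := by
    intro j hj
    rw [← hshift j hj]
    refine Finset.sum_congr rfl fun k _ => ?_
    ring
  rw [Finset.sum_congr rfl hshift']
  ring

theorem one_add_mul_cos_pos {s θ : ℝ} (hs : 0 < s) (hs1 : s ≤ 1) (hθ : θ ∈ Set.Ioo 0 Real.pi) :
    0 < 1 + s * Real.cos θ := by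
  have : -1 < Real.cos θ := by
    rw [← Real.cos_pi]
    exact Real.cos_lt_cos_of_nonneg_of_le_pi hθ.1.le le_rfl hθ.2
  nlinarith

theorem one_add_sq_add_two_mul_cos_pos {s θ : ℝ} (hs : 0 < s) (hs1 : s ≤ 1)
    (hθ : θ ∈ Set.Ioo 0 Real.pi) : 0 < 1 + s ^ 2 + 2 * s * Real.cos θ := by
  have := one_add_mul_cos_pos hs hs1 hθ
  nlinarith [Real.sin_sq_add_cos_sq θ, sq_nonneg (s * Real.sin θ), mul_pos this this]

theorem intervalIntegrable_and_integral_sin_sq_div {s : ℝ} (hs : 0 < s) (hs1 : s ≤ 1) :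
    IntervalIntegrable (fun θ => Real.sin θ ^ 2 / (1 + s ^ 2 + 2 * s * Real.cos θ)) volume
      0 Real.pi ∧
    ∫ θ in (0 : ℝ)..Real.pi, Real.sin θ ^ 2 / (1 + s ^ 2 + 2 * s * Real.cos θ)
      = Real.pi / 2 := by
  set F : ℝ → ℝ := fun θ => (1 / (4 * s ^ 2)) * ((1 + s ^ 2) * θ - 2 * s * Real.sin θ
    - (1 - s ^ 2) * (θ - 2 * Real.arctan (s * Real.sin θ / (1 + s * Real.cos θ)))) with hF
  have hcont : ContinuousOn F (Set.Icc 0 Real.pi) := by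
    rcases hs1.lt_or_eq with h | h
    · have : ∀ θ : ℝ, 1 + s * Real.cos θ ≠ 0 := fun θ => by
        nlinarith [Real.neg_one_le_cos θ]
      exact (by fun_prop (disch := assumption) : Continuous F).continuousOn
    · subst h
      have : F = fun θ => (1 / (4 * 1 ^ 2)) * ((1 + 1 ^ 2) * θ - 2 * 1 * Real.sin θ) := by
        ext θ
        simp [hF]
      rw [this]
      fun_prop
  have hderiv : ∀ θ ∈ Set.Ioo 0 Real.pi,
      HasDerivAt F (Real.sin θ ^ 2 / (1 + s ^ 2 + 2 * s * Real.cos θ)) θ := by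
    intro θ hθ
    have hc := one_add_mul_cos_pos hs hs1 hθ
    have hy := one_add_sq_add_two_mul_cos_pos hs hs1 hθ
    have hquot := ((Real.hasDerivAt_sin θ).const_mul s).div
      (((Real.hasDerivAt_cos θ).const_mul s).const_add 1) hc.ne'
    have harg : HasDerivAt
        (fun θ => Real.arctan (s * Real.sin θ / (1 + s * Real.cos θ)))
        ((s * Real.cos θ + s ^ 2) / (1 + s ^ 2 + 2 * s * Real.cos θ)) θ := by
      refine HasDerivAt.congr_deriv hquot.arctan ?_
      have hsc := Real.sin_sq θ
      have hy' : 1 + (s * Real.sin θ / (1 + s * Real.cos θ)) ^ 2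
          = (1 + s ^ 2 + 2 * s * Real.cos θ) / (1 + s * Real.cos θ) ^ 2 := by
        field_simp
        rw [hsc]
        ring
      simp only [Pi.div_apply]
      rw [hy']
      generalize 1 + s ^ 2 + 2 * s * Real.cos θ = y at hy ⊢
      field_simp
      linear_combination s * hsc
    have := (((((hasDerivAt_id θ).const_mul (1 + s ^ 2)).sub
      ((Real.hasDerivAt_sin θ).const_mul (2 * s))).sub
      (((hasDerivAt_id θ).sub (harg.const_mul 2)).const_mul (1 - s ^ 2))).const_mul
      (1 / (4 * s ^ 2)))
    refine HasDerivAt.congr_deriv this ?_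
    have hsc := Real.sin_sq θ
    obtain ⟨y, hyd⟩ : ∃ y, y = 1 + s ^ 2 + 2 * s * Real.cos θ := ⟨_, rfl⟩
    rw [← hyd] at hy ⊢
    field_simp
    rw [hsc, hyd]
    ring
  have hint : IntervalIntegrable
      (fun θ => Real.sin θ ^ 2 / (1 + s ^ 2 + 2 * s * Real.cos θ)) volume 0 Real.pi := by
    refine intervalIntegral.intervalIntegrable_deriv_of_nonneg
      (by rwa [Set.uIcc_of_le Real.pi_pos.le])
      (by simpa [Real.pi_pos.le] using hderiv) ?_
    intro θ hθ
    rw [min_eq_left Real.pi_pos.le, max_eq_right Real.pi_pos.le] at hθ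
    have := one_add_sq_add_two_mul_cos_pos hs hs1 hθ
    positivity
  refine ⟨hint, ?_⟩
  rw [intervalIntegral.integral_eq_sub_of_hasDerivAt_of_le Real.pi_pos.le hcont hderiv hint]
  simp only [hF, Real.sin_pi, Real.sin_zero, mul_zero, zero_div, Real.arctan_zero]
  field_simp
  ring

/-- The density of `mpMeasure l`, without the cut-off outside its support. -/
noncomputable def mpDensity (l y : ℝ) : ℝ :=
  (1 / (2 * Real.pi * l * y)) *
    Real.sqrt (((1 + Real.sqrt l) ^ 2 - y) * (y - (1 - Real.sqrt l) ^ 2))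

theorem measurable_mpDensity (l : ℝ) : Measurable (mpDensity l) := by
  unfold mpDensity
  fun_prop

theorem mpDensity_nonneg {l y : ℝ} (hl : 0 < l) (hy : (1 - Real.sqrt l) ^ 2 ≤ y) :
    0 ≤ mpDensity l y := by
  have : 0 ≤ y := (sq_nonneg _).trans hy
  have := Real.pi_pos
  unfold mpDensity
  positivity

theorem mpMeasure_eq (l : ℝ) :
    mpMeasure l = (volume.restrict
      (Set.Icc ((1 - Real.sqrt l) ^ 2) ((1 + Real.sqrt l) ^ 2))).withDensity
        (fun x => ENNReal.ofReal (mpDensity l x)) := by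
  rw [← withDensity_indicator measurableSet_Icc]
  unfold mpMeasure
  congr 1
  ext x
  by_cases hx : x ∈ Set.Icc ((1 - Real.sqrt l) ^ 2) ((1 + Real.sqrt l) ^ 2) <;>
    simp [hx, mpDensity]

theorem image_one_add_sq_add_two_mul_cos {s : ℝ} (hs : 0 < s) :
    (fun θ => 1 + s ^ 2 + 2 * s * Real.cos θ) '' Set.Icc 0 Real.pi
      = Set.Icc ((1 - s) ^ 2) ((1 + s) ^ 2) := by
  have h : (fun θ => 1 + s ^ 2 + 2 * s * Real.cos θ)
      = (fun c => 1 + s ^ 2 + 2 * s * c) ∘ Real.cos := rfl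
  rw [h, Set.image_comp, Real.bijOn_cos.image_eq]
  ext x
  constructor
  · rintro ⟨c, ⟨h1, h2⟩, rfl⟩
    constructor <;> dsimp only <;> nlinarith
  · rintro ⟨h1, h2⟩
    refine ⟨(x - 1 - s ^ 2) / (2 * s), ⟨?_, ?_⟩, ?_⟩
    · rw [le_div_iff₀ (by positivity)]; nlinarith
    · rw [div_le_iff₀ (by positivity)]; nlinarith
    · field_simp
      ring

theorem injOn_one_add_sq_add_two_mul_cos {s : ℝ} (hs : 0 < s) :
    Set.InjOn (fun θ => 1 + s ^ 2 + 2 * s * Real.cos θ) (Set.Icc 0 Real.pi) := by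
  intro x hx y hy h
  refine Real.injOn_cos hx hy ?_
  have h' : 2 * s * Real.cos x = 2 * s * Real.cos y := add_left_cancel h
  exact mul_left_cancel₀ (by positivity) h'

theorem hasDerivAt_one_add_sq_add_two_mul_cos (s θ : ℝ) :
    HasDerivAt (fun θ => 1 + s ^ 2 + 2 * s * Real.cos θ) (2 * s * -Real.sin θ) θ :=
  ((Real.hasDerivAt_cos θ).const_mul (2 * s)).const_add (1 + s ^ 2)

theorem abs_deriv_mul_mpDensity {l θ : ℝ} (hl : 0 < l) (hθ : θ ∈ Set.Icc 0 Real.pi) :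
    |2 * √l * -Real.sin θ| * mpDensity l (1 + √l ^ 2 + 2 * √l * Real.cos θ)
      = 2 / Real.pi * (Real.sin θ ^ 2 / (1 + √l ^ 2 + 2 * √l * Real.cos θ)) := by
  have hs : 0 < √l := Real.sqrt_pos.2 hl
  have hsin := Real.sin_nonneg_of_mem_Icc hθ
  have hsq : ((1 + √l) ^ 2 - (1 + √l ^ 2 + 2 * √l * Real.cos θ)) *
      ((1 + √l ^ 2 + 2 * √l * Real.cos θ) - (1 - √l) ^ 2) = (2 * √l * Real.sin θ) ^ 2 := by
    rw [mul_pow _ (Real.sin θ), Real.sin_sq]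
    ring
  rw [mpDensity, hsq, Real.sqrt_sq (by positivity), mul_neg, abs_neg,
    abs_of_nonneg (by positivity)]
  generalize 1 + √l ^ 2 + 2 * √l * Real.cos θ = y
  have hl2 : l = √l ^ 2 := (Real.sq_sqrt hl.le).symm
  have hpi := Real.pi_ne_zero
  rcases eq_or_ne y 0 with rfl | hy
  · simp
  · field_simp
    rw [← hl2]
    ring

theorem setIntegral_mpDensity_mul {l : ℝ} (hl : 0 < l) (g : ℝ → ℝ) :
    ∫ x in Set.Icc ((1 - √l) ^ 2) ((1 + √l) ^ 2), mpDensity l x * g x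
      = 2 / Real.pi * ∫ θ in (0 : ℝ)..Real.pi,
          Real.sin θ ^ 2 / (1 + √l ^ 2 + 2 * √l * Real.cos θ)
            * g (1 + √l ^ 2 + 2 * √l * Real.cos θ) := by
  have hs : 0 < √l := Real.sqrt_pos.2 hl
  rw [← image_one_add_sq_add_two_mul_cos hs,
    integral_image_eq_integral_abs_deriv_smul measurableSet_Icc
      (fun θ _ => (hasDerivAt_one_add_sq_add_two_mul_cos √l θ).hasDerivWithinAt)
      (injOn_one_add_sq_add_two_mul_cos hs),
    intervalIntegral.integral_of_le Real.pi_pos.le, ← integral_Icc_eq_integral_Ioc,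
    ← integral_const_mul]
  refine setIntegral_congr_fun measurableSet_Icc fun θ hθ => ?_
  simp only [smul_eq_mul]
  rw [← mul_assoc, abs_deriv_mul_mpDensity hl hθ, mul_assoc]

theorem integrableOn_mpDensity {l : ℝ} (hl : 0 < l) (hl1 : l ≤ 1) :
    IntegrableOn (mpDensity l) (Set.Icc ((1 - √l) ^ 2) ((1 + √l) ^ 2)) := by
  have hs : 0 < √l := Real.sqrt_pos.2 hl
  have hs1 : √l ≤ 1 := Real.sqrt_le_one.2 hl1
  rw [← image_one_add_sq_add_two_mul_cos hs,
    integrableOn_image_iff_integrableOn_abs_deriv_smul measurableSet_Icc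
      (fun θ _ => (hasDerivAt_one_add_sq_add_two_mul_cos √l θ).hasDerivWithinAt)
      (injOn_one_add_sq_add_two_mul_cos hs)]
  have h := (intervalIntegrable_iff_integrableOn_Icc_of_le Real.pi_pos.le).1
    (intervalIntegrable_and_integral_sin_sq_div hs hs1).1
  refine IntegrableOn.congr_fun (h.const_mul (2 / Real.pi)) (fun θ hθ => ?_) measurableSet_Icc
  rw [smul_eq_mul, abs_deriv_mul_mpDensity hl hθ]

theorem setIntegral_mpDensity {l : ℝ} (hl : 0 < l) (hl1 : l ≤ 1) :
    ∫ x in Set.Icc ((1 - √l) ^ 2) ((1 + √l) ^ 2), mpDensity l x = 1 := by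
  have h := setIntegral_mpDensity_mul hl fun _ => 1
  simp only [mul_one] at h
  rw [h, (intervalIntegrable_and_integral_sin_sq_div (Real.sqrt_pos.2 hl)
    (Real.sqrt_le_one.2 hl1)).2]
  have := Real.pi_ne_zero
  field_simp

theorem integral_mpMeasure {l : ℝ} (hl : 0 < l) (g : ℝ → ℝ) :
    ∫ x, g x ∂(mpMeasure l)
      = ∫ x in Set.Icc ((1 - √l) ^ 2) ((1 + √l) ^ 2), mpDensity l x * g x := by
  rw [mpMeasure_eq, integral_withDensity_eq_integral_toReal_smul
    (measurable_mpDensity l).ennreal_ofReal (by simp)]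
  refine setIntegral_congr_fun measurableSet_Icc fun x hx => ?_
  simp only [smul_eq_mul]
  rw [ENNReal.toReal_ofReal (mpDensity_nonneg hl hx.1)]

theorem isProbabilityMeasure_mpMeasure {l : ℝ} (hl : 0 < l) (hl1 : l ≤ 1) :
    IsProbabilityMeasure (mpMeasure l) := by
  refine ⟨?_⟩
  rw [mpMeasure_eq, withDensity_apply _ MeasurableSet.univ, Measure.restrict_univ,
    ← ofReal_integral_eq_lintegral_ofReal (integrableOn_mpDensity hl hl1),
    setIntegral_mpDensity hl hl1, ENNReal.ofReal_one]
  filter_upwards [ae_restrict_mem measurableSet_Icc] with x hx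
  exact mpDensity_nonneg hl hx.1

theorem integral_pow_succ_mpMeasure {l : ℝ} (hl : 0 < l) (hl1 : l ≤ 1) (n : ℕ) :
    ∫ x, x ^ (n + 1) ∂(mpMeasure l)
      = 2 / Real.pi * ∫ θ in (0 : ℝ)..Real.pi,
          Real.sin θ ^ 2 * (1 + √l ^ 2 + 2 * √l * Real.cos θ) ^ n := by
  rw [integral_mpMeasure hl, setIntegral_mpDensity_mul hl]
  congr 1
  rw [intervalIntegral.integral_of_le Real.pi_pos.le,
    intervalIntegral.integral_of_le Real.pi_pos.le, integral_Ioc_eq_integral_Ioo,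
    integral_Ioc_eq_integral_Ioo]
  refine setIntegral_congr_fun measurableSet_Ioo fun θ hθ => ?_
  have := one_add_sq_add_two_mul_cos_pos (Real.sqrt_pos.2 hl) (Real.sqrt_le_one.2 hl1) hθ
  rw [pow_succ' _ n, ← mul_assoc, div_mul_cancel₀]
  exact ne_of_gt this

/-- The Marčenko–Pastur distribution is a probability measure (in particular its `0`-th
moment is `1`), and for every `q ≥ 1` its `q`-th moment equals
`∑_{k=0}^{q-1} l^k · (1/(k+1)) · C(q,k) · C(q-1,k)` (a sum of Narayana numbers). -/
theorem mp_moments (l : ℝ) (hl : 0 < l) (hl1 : l ≤ 1) :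
    IsProbabilityMeasure (mpMeasure l) ∧
    ∀ q : ℕ, 1 ≤ q →
      ∫ x, x ^ q ∂(mpMeasure l)
        = ∑ k ∈ Finset.range q,
            l ^ k * (1 / (k + 1 : ℝ)) * (q.choose k : ℝ) * ((q - 1).choose k : ℝ) := by
  refine ⟨isProbabilityMeasure_mpMeasure hl hl1, fun q hq => ?_⟩
  obtain ⟨n, rfl⟩ := Nat.exists_eq_add_of_le' hq
  rw [integral_pow_succ_mpMeasure hl hl1, integral_sin_sq_mul_pow, Real.sq_sqrt hl.le,
    Nat.add_sub_cancel, sum_narayana_eq, ← mul_assoc, div_mul_div_cancel₀' two_ne_zero,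
    div_self Real.pi_ne_zero, one_mul]
end
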